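/- There is no rank-4 abstract polytope all of whose facets are isomorphic to the hemi-icosahedron {3,5}₅ and all of whose vertex figures are isomorphic to the dodecahedron {5,3}; dually, there is no rank-4 abstract polytope all of whose facets are isomorphic to the icosahedron {3,5} and all of whose vertex figures are isomorphic to the hemidodecahedron {5,3}₅. -/

import Mathlib

universe u v

/-- An abstract polytope of rank `n`: a bounded poset equipped with a rank function
taking values in `{-1, 0, ..., n}`, such that every maximal chain (flag) contains exactly
one face of each rank, satisfying the diamond condition and strong flag-connectivity. -/
structure APolytope (n : ℕ) : Type (u + 1) where
  /-- the type of faces -/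
  α : Type u
  [po : PartialOrder α]
  [bo : BoundedOrder α]
  /-- the rank function -/
  rank : α → ℤ
  rank_bot : rank ⊥ = -1
  rank_top : rank ⊤ = (n : ℤ)
  rank_strictMono : StrictMono rank
  rank_mem : ∀ F : α, rank F ∈ Set.Icc (-1 : ℤ) (n : ℤ)
  /-- every flag (maximal chain) contains exactly one face of each rank `-1, ..., n`
  (hence exactly `n + 2` faces) -/
  flag_ranks : ∀ c : Set α, IsMaxChain (· ≤ ·) c →
    ∀ i ∈ Set.Icc (-1 : ℤ) (n : ℤ), ∃! F, F ∈ c ∧ rank F = i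
  /-- the diamond condition -/
  diamond : ∀ F G : α, F < G → rank G = rank F + 2 →
    ∃ H₁ H₂ : α, H₁ ≠ H₂ ∧ ∀ H : α, (F < H ∧ H < G) ↔ (H = H₁ ∨ H = H₂)
  /-- strong flag-connectivity: any two flags `c`, `d` are joined by a sequence of
  flags, successive ones differing in exactly one face, all containing `c ∩ d` -/
  connected : ∀ c d : Set α, IsMaxChain (· ≤ ·) c → IsMaxChain (· ≤ ·) d →
    Relation.ReflTransGen
      (fun x y : Set α => IsMaxChain (· ≤ ·) y ∧ c ∩ d ⊆ y ∧
        (∃ F G : α, x \ y = {F} ∧ y \ x = {G})) c d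

attribute [instance] APolytope.po APolytope.bo

namespace APolytope

variable {n : ℕ}

/-- A flag of a polytope is a maximal chain. -/
def IsFlag (P : APolytope.{u} n) (c : Set P.α) : Prop := IsMaxChain (· ≤ ·) c

/-- Two polytopes are isomorphic when there is an order isomorphism between their
face posets. -/
def Iso (P : APolytope.{u} n) (Q : APolytope.{v} n) : Prop := Nonempty (P.α ≃o Q.α)

/-- All facets (sections below a rank `n-1` face, including the least face) of `P`
are isomorphic to the poset `β`. In rank 4, facets are the sections `F/F₋₁` with
`rank F = 3`. -/
def FacetsAre (P : APolytope.{u} 4) (β : Type*) [PartialOrder β] : Prop :=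
  ∀ F : P.α, P.rank F = 3 → Nonempty (↥(Set.Iic F) ≃o β)

/-- All vertex figures (sections above a rank `0` face, up to the greatest face) of `P`
are isomorphic to the poset `β`. -/
def VertexFiguresAre (P : APolytope.{u} 4) (β : Type*) [PartialOrder β] : Prop :=
  ∀ x : P.α, P.rank x = 0 → Nonempty (↥(Set.Ici x) ≃o β)

end APolytope

def IcosaPosetData : Finset (Finset (Fin 64)) :=
  {{0},
   {0, 1},
   {0, 2},
   {0, 3},
   {0, 4},
   {0, 5},
   {0, 6},
   {0, 7},
   {0, 8},
   {0, 9},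
   {0, 10},
   {0, 11},
   {0, 12},
   {0, 1, 2, 13},
   {0, 1, 3, 14},
   {0, 1, 5, 15},
   {0, 1, 7, 16},
   {0, 1, 9, 17},
   {0, 2, 3, 18},
   {0, 2, 6, 19},
   {0, 2, 7, 20},
   {0, 2, 8, 21},
   {0, 3, 4, 22},
   {0, 3, 8, 23},
   {0, 3, 9, 24},
   {0, 4, 8, 25},
   {0, 4, 9, 26},
   {0, 4, 10, 27},
   {0, 4, 11, 28},
   {0, 5, 7, 29},
   {0, 5, 9, 30},
   {0, 5, 11, 31},
   {0, 5, 12, 32},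
   {0, 6, 7, 33},
   {0, 6, 8, 34},
   {0, 6, 10, 35},
   {0, 6, 12, 36},
   {0, 7, 12, 37},
   {0, 8, 10, 38},
   {0, 9, 11, 39},
   {0, 10, 11, 40},
   {0, 10, 12, 41},
   {0, 11, 12, 42},
   {0, 1, 2, 3, 13, 14, 18, 43},
   {0, 1, 2, 7, 13, 16, 20, 44},
   {0, 1, 3, 9, 14, 17, 24, 45},
   {0, 1, 5, 7, 15, 16, 29, 46},
   {0, 1, 5, 9, 15, 17, 30, 47},
   {0, 2, 3, 8, 18, 21, 23, 48},
   {0, 2, 6, 7, 19, 20, 33, 49},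
   {0, 2, 6, 8, 19, 21, 34, 50},
   {0, 3, 4, 8, 22, 23, 25, 51},
   {0, 3, 4, 9, 22, 24, 26, 52},
   {0, 4, 8, 10, 25, 27, 38, 53},
   {0, 4, 9, 11, 26, 28, 39, 54},
   {0, 4, 10, 11, 27, 28, 40, 55},
   {0, 5, 7, 12, 29, 32, 37, 56},
   {0, 5, 9, 11, 30, 31, 39, 57},
   {0, 5, 11, 12, 31, 32, 42, 58},
   {0, 6, 7, 12, 33, 36, 37, 59},
   {0, 6, 8, 10, 34, 35, 38, 60},
   {0, 6, 10, 12, 35, 36, 41, 61},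
   {0, 10, 11, 12, 40, 41, 42, 62},
   {0, 1, 2, 3, 4, 5, 6, 7, 8, 9, 10, 11, 12, 13, 14, 15, 16, 17, 18, 19, 20, 21, 22, 23, 24, 25, 26, 27, 28, 29, 30, 31, 32, 33, 34, 35, 36, 37, 38, 39, 40, 41, 42, 43, 44, 45, 46, 47, 48, 49, 50, 51, 52, 53, 54, 55, 56, 57, 58, 59, 60, 61, 62, 63}}

abbrev IcosaPoset := {S : Finset (Fin 64) // S ∈ IcosaPosetData}

def HemiIcosaPosetData : Finset (Finset (Fin 33)) :=
  {{0},
   {0, 1},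
   {0, 2},
   {0, 3},
   {0, 4},
   {0, 5},
   {0, 6},
   {0, 1, 2, 7},
   {0, 1, 3, 8},
   {0, 1, 5, 9},
   {0, 1, 4, 10},
   {0, 1, 6, 11},
   {0, 2, 3, 12},
   {0, 2, 6, 13},
   {0, 2, 4, 14},
   {0, 2, 5, 15},
   {0, 3, 4, 16},
   {0, 3, 5, 17},
   {0, 3, 6, 18},
   {0, 4, 5, 19},
   {0, 4, 6, 20},
   {0, 5, 6, 21},
   {0, 1, 2, 3, 7, 8, 12, 22},
   {0, 1, 2, 4, 7, 10, 14, 23},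
   {0, 1, 3, 6, 8, 11, 18, 24},
   {0, 1, 4, 5, 9, 10, 19, 25},
   {0, 1, 5, 6, 9, 11, 21, 26},
   {0, 2, 3, 5, 12, 15, 17, 27},
   {0, 2, 4, 6, 13, 14, 20, 28},
   {0, 2, 5, 6, 13, 15, 21, 29},
   {0, 3, 4, 5, 16, 17, 19, 30},
   {0, 3, 4, 6, 16, 18, 20, 31},
   {0, 1, 2, 3, 4, 5, 6, 7, 8, 9, 10, 11, 12, 13, 14, 15, 16, 17, 18, 19, 20, 21, 22, 23, 24, 25, 26, 27, 28, 29, 30, 31, 32}}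

abbrev HemiIcosaPoset := {S : Finset (Fin 33) // S ∈ HemiIcosaPosetData}

/-- The dodecahedron is the order dual of the icosahedron. -/
abbrev DodecaPoset := IcosaPosetᵒᵈ

/-- The hemidodecahedron is the order dual of the hemi-icosahedron. -/
abbrev HemiDodecaPoset := HemiIcosaPosetᵒᵈ

/-- The flags of a poset of rank `m`, without their least and greatest faces: strictly increasing
sequences of `m` elements that are neither minimal nor maximal. -/
def ProperFlag (α : Type*) [PartialOrder α] (m : ℕ) : Type _ :=
  {f : Fin m → α // StrictMono f ∧ ∀ i, ¬ IsMin (f i) ∧ ¬ IsMax (f i)}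

namespace ProperFlag

section Flip

variable {α β : Type*} [PartialOrder α] [PartialOrder β] {m : ℕ}

/-- Two flags are `i`-adjacent when they differ in the `i`-th face and nowhere else. -/
def Adj (i : Fin m) (f g : ProperFlag α m) : Prop :=
  g.1 i ≠ f.1 i ∧ ∀ j ≠ i, g.1 j = f.1 j

/-- Every flag has exactly one `i`-adjacent flag for every `i`. -/
def Thin (α : Type*) [PartialOrder α] (m : ℕ) : Prop :=
  ∀ (f : ProperFlag α m) (i : Fin m), ∃! g, Adj i f g

/-- The `i`-adjacent flag. -/
noncomputable def flip (h : Thin α m) (i : Fin m) (f : ProperFlag α m) : ProperFlag α m :=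
  (h f i).choose

lemma adj_flip (h : Thin α m) (i : Fin m) (f : ProperFlag α m) : Adj i f (flip h i f) :=
  (h f i).choose_spec.1

lemma Adj.symm {i : Fin m} {f g : ProperFlag α m} (H : Adj i f g) : Adj i g f :=
  ⟨H.1.symm, fun j hj => (H.2 j hj).symm⟩

lemma Adj.flip_eq (h : Thin α m) {i : Fin m} {f g : ProperFlag α m} (H : Adj i f g) :
    flip h i f = g :=
  (h f i).unique (adj_flip h i f) H

lemma flip_flip (h : Thin α m) (i : Fin m) (f : ProperFlag α m) : flip h i (flip h i f) = f :=
  (adj_flip h i f).symm.flip_eq h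

lemma flip_comm (h : Thin α m) {i j : Fin m} (hij : (i : ℕ) + 1 < j) (f : ProperFlag α m) :
    flip h j (flip h i f) = flip h i (flip h j f) := by
  obtain ⟨hi, hi'⟩ := adj_flip h i f
  obtain ⟨hj, hj'⟩ := adj_flip h j f
  have hne : i ≠ j := by rintro rfl; omega
  set p := flip h i f
  set q := flip h j f
  have key : ∀ k, Function.update q.1 i (p.1 i) k =
      if k = i then p.1 i else if k = j then q.1 j else f.1 k := by
    intro k
    by_cases hki : k = i
    · subst hki; simp
    · by_cases hkj : k = j
      · subst hkj; simp [hki]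
      · simp [hki, hkj, hj' k hkj]
  have mono : StrictMono (Function.update q.1 i (p.1 i)) := by
    intro k l hkl
    rw [key, key]
    by_cases hli : l = i
    · have hki : k ≠ i := by rintro rfl; exact absurd hli hkl.ne'
      have hkj : k ≠ j := by rintro rfl; subst hli; simp only [Fin.lt_def] at hkl; omega
      simp only [hki, hkj, hli, if_true, if_false, ← hi' k hki]
      exact p.2.1 (hli ▸ hkl)
    by_cases hki : k = i
    · by_cases hlj : l = j
      · subst hki hlj
        let u : Fin m := ⟨k + 1, by omega⟩
        have h1 : k < u := Fin.lt_def.2 (by simp [u])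
        have h2 : u < l := Fin.lt_def.2 hij
        simp only [if_true, if_neg hli]
        calc p.1 k < p.1 u := p.2.1 h1
          _ = q.1 u := by rw [hi' u h1.ne', hj' u h2.ne]
          _ < q.1 l := q.2.1 h2
      · simp only [hki, hli, hlj, if_true, if_false, ← hi' l hli]
        exact p.2.1 (hki ▸ hkl)
    · have e : ∀ k, k ≠ i → (if k = i then p.1 i else if k = j then q.1 j else f.1 k) = q.1 k := by
        intro k hk
        by_cases hkj : k = j
        · subst hkj; simp [hk]
        · simp [hk, hkj, hj' k hkj]
      rw [e k hki, e l hli]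
      exact q.2.1 hkl
  let r : ProperFlag α m := ⟨Function.update q.1 i (p.1 i), mono, fun k => by
    by_cases hk : k = i
    · subst hk; simpa using p.2.2 k
    · simpa [hk] using q.2.2 k⟩
  have h1 : Adj j p r := by
    refine ⟨?_, fun k hk => ?_⟩
    · simpa [r, hne.symm, hi' j hne.symm] using hj
    · by_cases hki : k = i
      · subst hki; simp [r]
      · simp [r, hki, hi' k hki, hj' k hk]
  have h2 : Adj i q r := by
    refine ⟨?_, fun k hk => ?_⟩
    · simpa [r, hj' i hne] using hi
    · simp [r, hk]
  rw [h1.flip_eq h, h2.flip_eq h]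

/-- Successive flips, along a word read from right to left. -/
noncomputable def act (h : Thin α m) (w : List (Fin m)) (f : ProperFlag α m) : ProperFlag α m :=
  w.foldr (flip h) f

/-- The dual of a flag, in the dual poset. -/
def dual (f : ProperFlag α m) : ProperFlag αᵒᵈ m :=
  ⟨fun i => OrderDual.toDual (f.1 i.rev), fun _ _ hij => f.2.1 (Fin.rev_lt_rev.2 hij),
    fun i => ⟨fun hm => (f.2.2 i.rev).2 hm.ofDual, fun hm => (f.2.2 i.rev).1 hm.ofDual⟩⟩

lemma dual_injective : Function.Injective (dual : ProperFlag α m → ProperFlag αᵒᵈ m) := by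
  intro f g hfg
  refine Subtype.ext (funext fun i => ?_)
  simpa [dual] using congrFun (congrArg Subtype.val hfg) i.rev

lemma dual_surjective : Function.Surjective (dual : ProperFlag α m → ProperFlag αᵒᵈ m) := by
  intro f
  refine ⟨⟨fun i => OrderDual.ofDual (f.1 i.rev), fun _ _ hij => f.2.1 (Fin.rev_lt_rev.2 hij),
    fun i => ⟨fun hm => (f.2.2 i.rev).2 hm.toDual, fun hm => (f.2.2 i.rev).1 hm.toDual⟩⟩, ?_⟩
  exact Subtype.ext (funext fun i => by simp [dual])

lemma adj_dual {i : Fin m} {f g : ProperFlag α m} : Adj i.rev f.dual g.dual ↔ Adj i f g := by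
  refine and_congr (by simp [dual]) ⟨fun H j hj => ?_, fun H j hj => ?_⟩
  · simpa [dual] using H j.rev (by simpa using hj)
  · exact congrArg OrderDual.toDual (H j.rev fun hc => hj (by simp [← hc]))

lemma Thin.dual (h : Thin α m) : Thin αᵒᵈ m := by
  intro f i
  obtain ⟨f, rfl⟩ := dual_surjective f
  obtain ⟨j, rfl⟩ : ∃ j : Fin m, j.rev = i := ⟨i.rev, Fin.rev_rev i⟩
  refine ⟨(flip h j f).dual, adj_dual.2 (adj_flip h j f), fun g hg => ?_⟩
  obtain ⟨g, rfl⟩ := dual_surjective g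
  rw [(adj_dual.1 hg).flip_eq h]

lemma act_dual (h : Thin α m) (w : List (Fin m)) (f : ProperFlag α m) :
    act h.dual (w.map Fin.rev) f.dual = (act h w f).dual := by
  induction w with
  | nil => rfl
  | cons i w ih =>
    change flip h.dual i.rev (act h.dual (w.map Fin.rev) f.dual) = (flip h i (act h w f)).dual
    rw [ih]
    exact (adj_dual.2 (adj_flip h i _)).flip_eq h.dual

/-- The flag induced on a facet, carried along an isomorphism. -/
def toFacet {F : α} (e : Set.Iic F ≃o β) (f : ProperFlag α (m + 1)) (hf : f.1 (Fin.last m) = F) :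
    ProperFlag β m :=
  have hlt (i : Fin m) : f.1 i.castSucc < F := hf ▸ f.2.1 i.castSucc_lt_last
  ⟨fun i => e ⟨f.1 i.castSucc, (hlt i).le⟩,
    fun i j hij => e.strictMono (f.2.1 (Fin.castSucc_lt_castSucc_iff.2 hij)), fun i => by
      rw [e.isMin_apply, e.isMax_apply]
      refine ⟨fun hm => (f.2.2 i.castSucc).1 fun y hy => ?_, fun hm => ?_⟩
      · exact hm (b := ⟨y, hy.trans (hlt i).le⟩) hy
      · exact (hm (b := ⟨F, le_rfl⟩) (hlt i).le).not_gt (hlt i)⟩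

/-- If flips on the flags of `β` are computed, after an injective encoding, by `t`, then a word in
the flips of a facet isomorphic to `β` fixes a flag exactly when it fixes its encoding. -/
lemma exists_act_eq_iff {τ : Type*} (h : Thin α (m + 1)) (enc : ProperFlag β m → τ)
    (henc : Function.Injective enc) (t : Fin m → τ → τ)
    (ht : ∀ i f g, Adj i f g → t i (enc f) = enc g) (f : ProperFlag α (m + 1))
    (e : Set.Iic (f.1 (Fin.last m)) ≃o β) :
    ∃ g : ProperFlag β m, ∀ w : List (Fin m),
      act h (w.map Fin.castSucc) f = f ↔ w.foldr t (enc g) = enc g := by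
  refine ⟨toFacet e f rfl, fun w => ?_⟩
  have key : ∃ hw : (act h (w.map Fin.castSucc) f).1 (Fin.last m) = f.1 (Fin.last m),
      w.foldr t (enc (toFacet e f rfl)) = enc (toFacet e _ hw) := by
    induction w with
    | nil => exact ⟨rfl, rfl⟩
    | cons i w ih =>
      obtain ⟨hw, ih⟩ := ih
      have ha := adj_flip h i.castSucc (act h (w.map Fin.castSucc) f)
      refine ⟨(ha.2 _ i.castSucc_lt_last.ne').trans hw, ?_⟩
      rw [List.foldr_cons, ih]
      refine ht _ _ _ ⟨fun hc => ha.1 ?_, fun j hj => ?_⟩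
      · exact congrArg Subtype.val (e.injective hc)
      · exact congrArg e (Subtype.ext (ha.2 _ fun hc => hj (Fin.castSucc_injective _ hc)))
  obtain ⟨hw, key⟩ := key
  rw [key, henc.eq_iff]
  refine ⟨fun H => ?_, fun H => Subtype.ext (funext fun i => ?_)⟩
  · congr 1
  · induction i using Fin.lastCases with
    | last => exact hw
    | cast i =>
      exact congrArg Subtype.val (e.injective (congrFun (congrArg Subtype.val H) i))

end Flip

end ProperFlag

namespace FaceCode

/-- Finite sets coded as natural numbers by their characteristic functions. -/
def code {n : ℕ} (S : Finset (Fin n)) : ℕ := Nat.ofBits fun j => decide (j ∈ S)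

/-- Strict inclusion of coded sets. -/
def lt (a b : ℕ) : Bool := (a &&& b).beq a && !a.beq b

lemma code_injective {n : ℕ} : Function.Injective (code : Finset (Fin n) → ℕ) := by
  intro S T h
  ext j
  have := congrArg (fun k => Nat.testBit k j) h
  simpa [code, Nat.testBit_ofBits_lt] using this

lemma lt_code {n : ℕ} {S T : Finset (Fin n)} (h : S < T) : lt (code S) (code T) := by
  have hne : code S ≠ code T := fun hc => h.ne (code_injective hc)
  suffices code S &&& code T = code S by simpa [lt, this, Bool.eq_false_iff] using hne
  refine Nat.eq_of_testBit_eq fun i => ?_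
  by_cases hi : i < n
  · have := Finset.mem_of_subset h.le (a := ⟨i, hi⟩)
    simpa [code, Nat.testBit_ofBits_lt, hi] using this
  · simp [code, Nat.testBit_ofBits_ge _ _ (not_lt.1 hi)]

/-- The flips on coded flags, found by search in the list `K` of coded faces. -/
def flip (K : List ℕ) (i : Fin 3) (x : ℕ × ℕ × ℕ) : ℕ × ℕ × ℕ :=
  match i with
  | 0 => ((K.find? fun y => lt y x.2.1 && !y.beq x.1).getD 0, x.2)
  | 1 => (x.1, (K.find? fun y => lt x.1 y && (lt y x.2.2 && !y.beq x.2.1)).getD 0, x.2.2)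
  | 2 => (x.1, x.2.1, (K.find? fun y => lt x.2.1 y && !y.beq x.2.2).getD 0)

/-- A property of all coded flags. -/
abbrev ForallFlags (K : List ℕ) (p : ℕ × ℕ × ℕ → Prop) : Prop :=
  ∀ a ∈ K, ∀ b ∈ K, lt a b → ∀ c ∈ K, lt b c → p (a, b, c)

/-- Coded faces different from those of a flag and adjacent to it are found by `flip`. -/
abbrev FlipSpec (K : List ℕ) (x : ℕ × ℕ × ℕ) : Prop :=
  ∀ y ∈ K, (y ≠ x.1 ∧ lt y x.2.1 → flip K 0 x = (y, x.2)) ∧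
    (y ≠ x.2.1 ∧ lt x.1 y ∧ lt y x.2.2 → flip K 1 x = (x.1, y, x.2.2)) ∧
    (y ≠ x.2.2 ∧ lt x.2.1 y → flip K 2 x = (x.1, x.2.1, y))

/-- The code of a flag of a poset of finite sets. -/
def encode {n : ℕ} {D : Finset (Finset (Fin n))}
    (f : ProperFlag {S : Finset (Fin n) // S ∈ D} 3) : ℕ × ℕ × ℕ :=
  (code (f.1 0).1, code (f.1 1).1, code (f.1 2).1)

section

variable {n : ℕ} {D : Finset (Finset (Fin n))} {K : List ℕ} {z : Fin n}

lemma encode_injective :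
    Function.Injective (encode : ProperFlag {S // S ∈ D} 3 → ℕ × ℕ × ℕ) := by
  intro f g h
  simp only [encode, Prod.mk.injEq, code_injective.eq_iff, ← Subtype.ext_iff] at h
  refine Subtype.ext (funext fun i => ?_)
  fin_cases i
  exacts [h.1, h.2.1, h.2.2]

lemma code_mem (hD : ∀ S ∈ D, z ∈ S ∧ (S = {z} ∨ code S ∈ K ∨ S = Finset.univ))
    (f : ProperFlag {S // S ∈ D} 3) (i : Fin 3) : code (f.1 i).1 ∈ K := by
  rcases (hD _ (f.1 i).2).2 with h | h | h
  · exact absurd (fun T _ x hx => Finset.mem_singleton.1 (h ▸ hx) ▸ (hD _ T.2).1) (f.2.2 i).1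
  · exact h
  · exact absurd (fun T _ x _ => h ▸ Finset.mem_univ x) (f.2.2 i).2

lemma ForallFlags.encode {p : ℕ × ℕ × ℕ → Prop} (h : ForallFlags K p)
    (hD : ∀ S ∈ D, z ∈ S ∧ (S = {z} ∨ code S ∈ K ∨ S = Finset.univ))
    (f : ProperFlag {S // S ∈ D} 3) : p (encode f) :=
  h _ (code_mem hD f 0) _ (code_mem hD f 1) (lt_code (f.2.1 (by decide))) _ (code_mem hD f 2)
    (lt_code (f.2.1 (by decide)))

lemma flip_encode (h : ForallFlags K (FlipSpec K))
    (hD : ∀ S ∈ D, z ∈ S ∧ (S = {z} ∨ code S ∈ K ∨ S = Finset.univ))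
    (i : Fin 3) (f g : ProperFlag {S // S ∈ D} 3) (hfg : ProperFlag.Adj i f g) :
    flip K i (encode f) = encode g := by
  obtain ⟨h0, h1, h2⟩ := h.encode hD f _ (code_mem hD g i)
  have hne : code (g.1 i).1 ≠ code (f.1 i).1 :=
    fun hc => hfg.1 (Subtype.ext (code_injective hc))
  have h01 := lt_code (g.2.1 (show (0 : Fin 3) < 1 by decide))
  have h12 := lt_code (g.2.1 (show (1 : Fin 3) < 2 by decide))
  have hg := hfg.2
  fin_cases i
  · rw [hg 1 (by decide)] at h01
    refine (h0 ⟨hne, h01⟩).trans ?_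
    simp [encode, hg 1 (by decide), hg 2 (by decide)]
  · rw [hg 0 (by decide)] at h01
    rw [hg 2 (by decide)] at h12
    refine (h1 ⟨hne, h01, h12⟩).trans ?_
    simp [encode, hg 0 (by decide), hg 2 (by decide)]
  · rw [hg 1 (by decide)] at h12
    refine (h2 ⟨hne, h12⟩).trans ?_
    simp [encode, hg 0 (by decide), hg 1 (by decide)]

end

/-- The codes of the proper faces of the icosahedron. -/
def icosaCodes : List ℕ :=
  [3, 5, 9, 17, 33, 65, 129, 257, 513, 1025, 2049, 4097, 8199, 16395, 32803, 65667, 131587,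
   262157, 524357, 1048709, 2097413, 4194329, 8388873, 16777737, 33554705, 67109393, 134218769,
   268437521, 536871073, 1073742369, 2147485729, 4294971425, 8589934785, 17179869505,
   34359739457, 68719480897, 137438957697, 274877908225, 549755816449, 1099511630849,
   2199023260673, 4398046517249, 8796093308943, 17592187166855, 35184389014027, 70369281147043,
   140738562261539, 281474987458829, 562958544928965, 1125917089333573, 2251799859822873,
   4503599715451417, 9007474300421393, 18014948600842769, 36029896933248017, 72057736308723873,
   144115741052897825, 288234780640679969, 576460967051792577, 1152921831024362817,
   2305845311316169793, 4611693715008789505]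

/-- The codes of the proper faces of the hemi-icosahedron. -/
def hemiIcosaCodes : List ℕ :=
  [3, 5, 9, 17, 33, 65, 135, 267, 547, 1043, 2115, 4109, 8261, 16405, 32805, 65561, 131113,
   262217, 524337, 1048657, 2097249, 4198799, 8406167, 17041739, 34080307, 69208675, 134385709,
   269508693, 539009125, 1074462777, 2148859993]

lemma icosa_codes : ∀ S ∈ IcosaPosetData,
    0 ∈ S ∧ (S = {0} ∨ code S ∈ icosaCodes ∨ S = Finset.univ) := by
  simp only [IcosaPosetData, Finset.forall_mem_insert, Finset.mem_singleton, forall_eq]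
  and_intros <;> decide +kernel

lemma hemiIcosa_codes : ∀ S ∈ HemiIcosaPosetData,
    0 ∈ S ∧ (S = {0} ∨ code S ∈ hemiIcosaCodes ∨ S = Finset.univ) := by
  simp only [HemiIcosaPosetData, Finset.forall_mem_insert, Finset.mem_singleton, forall_eq]
  and_intros <;> decide +kernel

lemma icosa_flip : ForallFlags icosaCodes (FlipSpec icosaCodes) := by
  decide +kernel

lemma hemiIcosa_flip : ForallFlags hemiIcosaCodes (FlipSpec hemiIcosaCodes) := by
  decide +kernel

lemma icosa_relations : ForallFlags icosaCodes fun x =>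
    [0, 1, 0, 1, 0, 1].foldr (flip icosaCodes) x = x ∧
    [1, 2, 0, 1, 2, 0, 1, 2, 0, 1, 2, 0, 1, 2, 0].foldr (flip icosaCodes) x ≠ x := by
  decide +kernel

lemma hemiIcosa_relations : ForallFlags hemiIcosaCodes fun x =>
    [1, 0, 1, 0, 1, 0].foldr (flip hemiIcosaCodes) x = x ∧
    [2, 1, 2, 1, 2, 1, 2, 1, 2, 1].foldr (flip hemiIcosaCodes) x = x ∧
    [1, 2, 0, 1, 2, 0, 1, 2, 0, 1, 2, 0, 1, 2, 0].foldr (flip hemiIcosaCodes) x = x := by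
  decide +kernel

end FaceCode

/-- A consequence of the defining relations of the Coxeter group `[3, 5, 3]` and the relation
`(abc)⁵ = 1`, for an action on `X` of involutions `a`, `b`, `c`, `d`. -/
theorem coxeter_collapse {X : Type*} (a b c d : X → X)
    (haa : ∀ x, a (a x) = x) (hbb : ∀ x, b (b x) = x) (hcc : ∀ x, c (c x) = x)
    (hdd : ∀ x, d (d x) = x) (hca : ∀ x, c (a x) = a (c x)) (hda : ∀ x, d (a x) = a (d x))
    (hdb : ∀ x, d (b x) = b (d x))
    (hab : ∀ x, b (a (b (a (b (a x))))) = x)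
    (hbc : ∀ x, c (b (c (b (c (b (c (b (c (b x))))))))) = x)
    (hcd : ∀ x, d (c (d (c (d (c x))))) = x)
    (habc : ∀ x, b (c (a (b (c (a (b (c (a (b (c (a (b (c (a x)))))))))))))) = x)
    (x : X) : c (b (d (c (b (d (c (b (d (c (b (d (c (b (d x)))))))))))))) = x := by
  have hbab (x : X) : b (a (b x)) = a (b (a x)) := by
    simpa only [haa, hbb] using
      hab (a (b (a x)))
  have hdcd (x : X) : d (c (d x)) = c (d (c x)) := by
    simpa only [hcc, hdd] using
      hcd (c (d (c x)))
  have hcbcbc (x : X) : c (b (c (b (c x)))) = b (c (b (c (b x)))) := by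
    simpa only [hbb, hcc] using
      hbc (b (c (b (c (b x)))))
  have hacbacbac (x : X) : a (c (b (a (c (b (a (c x))))))) = b (a (c (b (a (c (b x)))))) := by
    simpa only [haa, hbb, hca, hcc] using
      (habc (a (c (b (a (c (b (a (c x))))))))).symm
  have hdcbd (x : X) : d (c (b (d x))) = c (d (c (b x))) :=
    (congrArg (fun y => d (c y)) (hdb x)).symm.trans (hdcd _)
  have hdcbad (x : X) : d (c (b (a (d x)))) = c (d (c (b (a x)))) :=
    (congrArg (fun y => d (c (b y))) (hda x)).symm.trans (hdcbd _)
  have hdcbcdc (x : X) : d (c (b (c (d (c x))))) = c (d (c (b (c (d x))))) :=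
    (congrArg (fun y => d (c (b y))) (hdcd x)).symm.trans (hdcbd _)
  have hdcbacdc (x : X) : d (c (b (a (c (d (c x)))))) = c (d (c (b (a (c (d x)))))) :=
    (congrArg (fun y => d (c (b (a y)))) (hdcd x)).symm.trans (hdcbad _)
  have hcbcbac (x : X) : c (b (c (b (a (c x))))) = b (c (b (c (b (a x))))) :=
    (congrArg (fun y => c (b (c (b y)))) (hca x)).symm.trans (hcbcbc _)
  have hbacbacba (x : X) : b (a (c (b (a (c (b (a x))))))) = a (c (b (a (c (b (c x)))))) := by
    simpa only [haa] using
      (hacbacbac _).symm.trans (congrArg (fun y => a (c (b (a (c (b (a y))))))) (hca x))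
  have hadcbacbac (x : X) : a (d (c (b (a (c (b (a (c x)))))))) = b (a (d (c (b (a (c (b x)))))))
      := by
    simpa only [hdb, hda] using
      (hda _).symm.trans (congrArg (fun y => d y) (hacbacbac x))
  have hacbacbcb (x : X) : a (c (b (a (c (b (c (b x))))))) = b (a (c (b (c (b (a x)))))) := by
    simpa only [hca, haa] using
      (hbacbacba _).symm.trans (congrArg (fun y => b (a (c (b (a (c y)))))) (hbab x))
  have hadcbacbcb (x : X) : a (d (c (b (a (c (b (c (b x)))))))) = b (a (d (c (b (c (b (a x)))))))
      := by
    simpa only [hdb, hda] using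
      (hda _).symm.trans (congrArg (fun y => d y) (hacbacbcb x))
  have habadcbcba (x : X) : a (b (a (d (c (b (c (b (a x)))))))) = d (c (b (a (c (b (c (b x)))))))
      :=
    (congrArg (fun y => a y) (hadcbacbcb x)).symm.trans (haa _)
  have hacbadcbcba (x : X) : a (c (b (a (d (c (b (c (b (a x))))))))) = c (d (c (b (a (c (b (c (b
      x)))))))) :=
    (hca _).symm.trans (congrArg (fun y => c y) (habadcbcba x))
  have hdcbcbdcbcb (x : X) : d (c (b (c (b (d (c (b (c (b x))))))))) = c (d (c (b (c (b (d (c (b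
      (c x))))))))) := by
    simpa only [hdb] using
      (congrArg (fun y => d (c (b (c (d y))))) (hcbcbc x)).symm.trans (hdcbcdc _)
  have hacdcbacbac (x : X) : a (c (d (c (b (a (c (b (a (c x))))))))) = c (b (a (d (c (b (a (c (b
      x)))))))) :=
    (hca _).symm.trans (congrArg (fun y => c y) (hadcbacbac x))
  have hdcbacbdcbcb (x : X) : d (c (b (a (c (b (d (c (b (c (b x)))))))))) = c (d (c (b (a (c (b (d
      (c (b (c x)))))))))) := by
    simpa only [hdb] using
      (congrArg (fun y => d (c (b (a (c (d y)))))) (hcbcbc x)).symm.trans (hdcbacdc _)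
  have hbacbcdcbacbcb (x : X) : b (a (c (b (c (d (c (b (a (c (b (c (b x)))))))))))) = a (c (b (a
      (c (b (c (d (c (b (c (b (a x)))))))))))) :=
    (congrArg (fun y => b (a (c (b y)))) (hacbadcbcba x)).symm.trans (hbacbacba _)
  have hacbacbcdcbacba (x : X) : a (c (b (a (c (b (c (d (c (b (a (c (b (a x))))))))))))) = b (a (c
      (b (c (d (c (b (a (c (b (c x))))))))))) := by
    simpa only [hca, hbab] using
      (hbacbcdcbacbcb _).symm.trans (congrArg (fun y => b (a (c (b (c (d (c (b (a (c (b (c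
          y)))))))))))) (hbb x))
  have hcbacbcdcbacbc (x : X) : c (b (a (c (b (c (d (c (b (a (c (b (c x)))))))))))) = a (b (a (c
      (b (c (d (c (b (a (c (b (a x)))))))))))) := by
    simpa only [hcc] using
      (congrArg (fun y => c y) (hacbacbcdcbacba x)).symm.trans (hca _)
  have hcbacbcdcbacba (x : X) : c (b (a (c (b (c (d (c (b (a (c (b (a x)))))))))))) = a (b (a (c
      (b (c (d (c (b (a (c (b (c x)))))))))))) :=
    (haa _).symm.trans (congrArg (fun y => a y) (hacbacbcdcbacba x))
  have hbacdcbcbadcbcb (x : X) : b (a (c (d (c (b (c (b (a (d (c (b (c (b x))))))))))))) = a (d (c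
      (b (a (c (b (c (d (c (b (c (b (a x))))))))))))) := by
    simpa only [hdb, hda, hdcbcdc] using
      (hdb _).symm.trans (congrArg (fun y => d y) (hbacbcdcbacbcb x))
  have hdcbacbacdcbcbadcba (x : X) : d (c (b (a (c (b (a (c (d (c (b (c (b (a (d (c (b (a
      x))))))))))))))))) = c (b (d (c (b (c (b (a (d (c (b (c (b (a (d (c (b (c x)))))))))))))))))
      := by
    simpa only [hdb, hca, hda, hdcbcdc, hcbcbac] using
      (congrArg (fun y => d (c (b (c (d y))))) (hcbacbcdcbacbc x)).symm.trans (hdcbcdc _)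
  have hbacbdcbcbadcbcbdcbc (x : X) : b (a (c (b (d (c (b (c (b (a (d (c (b (c (b (d (c (b (c
      x)))))))))))))))))) = a (d (c (b (a (c (b (c (d (c (b (c (b (a (d (c (b (c (b
      x)))))))))))))))))) := by
    simpa only [hdb, hcbcbac] using
      (congrArg (fun y => b (a (c (d (c (b (c (b (a y))))))))) (hdcbcbdcbcb x)).symm.trans
          (hbacdcbcbadcbcb _)
  have habdcbcbadcbcbadcbc (x : X) : a (b (d (c (b (c (b (a (d (c (b (c (b (a (d (c (b (c
      x))))))))))))))))) = b (c (b (c (b (a (d (c (b (c (b (a (d (c (b (c (d x)))))))))))))))) :=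
      by
    simpa only [hdb, hca, hda, haa, hcc, hdcbcdc, hdcbacdc, hcbcbac, hdcbacbdcbcb,
      hcbacbcdcbacba] using
      (congrArg (fun y => a (c y)) (hdcbacbacdcbcbadcba x)).symm.trans (hacdcbacbac _)
  have habcbcbadcbcbadcbcd (x : X) : a (b (c (b (c (b (a (d (c (b (c (b (a (d (c (b (c (d
      x))))))))))))))))) = b (d (c (b (c (b (a (d (c (b (c (b (a (d (c (b (c x)))))))))))))))) :=
    (congrArg (fun y => a y) (habdcbcbadcbcbadcbc x)).symm.trans (haa _)
  have habcbcbadcbcbadcbacd (x : X) : a (b (c (b (c (b (a (d (c (b (c (b (a (d (c (b (a (c (d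
      x)))))))))))))))))) = b (d (c (b (c (b (a (d (c (b (c (b (a (d (c (b (a (c
      x))))))))))))))))) := by
    simpa only [hca] using
      (congrArg (fun y => a (b (c (b (c (b (a (d (c (b (c (b (a (d (c (b (c y)))))))))))))))))
          (hda x)).symm.trans (habcbcbadcbcbadcbcd _)
  have habcbcdcbacbcbdcbcd (x : X) : a (b (c (b (c (d (c (b (a (c (b (c (b (d (c (b (c (d
      x))))))))))))))))) = b (d (c (b (c (b (a (d (c (b (c (b (a (d (c (b x))))))))))))))) := by
    simpa only [hdb, hbab, hcc, hcbcbac, habadcbcba] using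
      (congrArg (fun y => a (b (c (b (c (b (a (d (c (b (c (b (a y))))))))))))) (hdcbcdc
          x)).symm.trans (habcbcbadcbcbadcbcd _)
  have hbcbcdcbacbcbdcbcd (x : X) : b (c (b (c (d (c (b (a (c (b (c (b (d (c (b (c (d
      x)))))))))))))))) = a (b (d (c (b (c (b (a (d (c (b (c (b (a (d (c (b x)))))))))))))))) :=
    (haa _).symm.trans (congrArg (fun y => a y) (habcbcdcbacbcbdcbcd x))
  have habcdcbcbadcbcbdcb (x : X) : a (b (c (d (c (b (c (b (a (d (c (b (c (b (d (c (b
      x)))))))))))))))) = b (c (b (c (d (c (b (a (c (b (c (b (d (c (b (c x))))))))))))))) := by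
    simpa only [hdb, hda, hbab, hdcbd, hdcbcdc, hcbcbac, habadcbcba] using
      (hbcbcdcbacbcbdcbcd _).symm.trans (congrArg (fun y => b (c (b (c (d (c (b (a (c (b (c (b (d
          (c (b (c y)))))))))))))))) (hdd x))
  have hbcbcdcbacbcbdcbcb (x : X) : b (c (b (c (d (c (b (a (c (b (c (b (d (c (b (c (b
      x)))))))))))))))) = a (b (c (d (c (b (c (b (a (d (c (b (c (b (d (c x))))))))))))))) :=
    (habcdcbcbadcbcbdcb _).symm.trans (congrArg (fun y => a (b (c (d (c (b (c (b (a (d (c (b (c (b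
        (d (c y)))))))))))))))) (hbb x))
  have hcbcdcbacbcbdcbcb (x : X) : c (b (c (d (c (b (a (c (b (c (b (d (c (b (c (b x)))))))))))))))
      = d (c (b (a (c (b (c (d (c (b (c (b (a (d (c x)))))))))))))) := by
    simpa only [haa, hbab, hbacdcbcbadcbcb] using
      (hbb _).symm.trans (congrArg (fun y => b y) (hbcbcdcbacbcbdcbcb x))
  have hdcbacbcdcbcbadcb (x : X) : d (c (b (a (c (b (c (d (c (b (c (b (a (d (c (b x)))))))))))))))
      = c (b (c (d (c (b (a (c (b (c (b (d (c (b (c x)))))))))))))) :=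
    (hcbcdcbacbcbdcbcb _).symm.trans (congrArg (fun y => c (b (c (d (c (b (a (c (b (c (b (d (c (b
        (c y))))))))))))))) (hbb x))
  have hcdcbcbadcbcbdcbc (x : X) : c (d (c (b (c (b (a (d (c (b (c (b (d (c (b (c x)))))))))))))))
      = c (b (a (c (b (c (d (c (b (c (b (a (d (c (b x)))))))))))))) := by
    simpa only [hdb, hda, hdcbcdc] using
      (congrArg (fun y => d y) (hdcbacbcdcbcbadcb x)).symm.trans (hdd _)
  have hdcbcbadcbcbdcbc (x : X) : d (c (b (c (b (a (d (c (b (c (b (d (c (b (c x)))))))))))))) = b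
      (a (c (b (c (d (c (b (c (b (a (d (c (b x))))))))))))) := by
    simpa only [hcc] using
      (hcc _).symm.trans (congrArg (fun y => c y) (hcdcbcbadcbcbdcbc x))
  have hacbcdcbacbcbdc (x : X) : a (c (b (c (d (c (b (a (c (b (c (b (d (c x))))))))))))) = c (d (c
      (b (c (b (a (d (c (b x))))))))) := by
    simpa only [hca, haa, hbb, hcc, hdcbacbcdcbcbadcb, hdcbcbadcbcbdcbc] using
      (hbacbdcbcbadcbcbdcbc x).symm
  have hacbcbadcbcbadc (x : X) : a (c (b (c (b (a (d (c (b (c (b (a (d (c x))))))))))))) = c (b (d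
      (c (b (c (b (a (d (c (b x)))))))))) := by
    simpa only [hdb, hca, hda, hbab, hcbcbc, hdcbd, hcbcbac, hacbacbcb] using
      (congrArg (fun y => a (c (b (c (d (c (b (a (c (b (c (b y)))))))))))) (hdcd x)).symm.trans
          (hacbcdcbacbcbdc _)
  have hcbcbadcbcbadc (x : X) : c (b (c (b (a (d (c (b (c (b (a (d (c x)))))))))))) = a (c (b (d
      (c (b (c (b (a (d (c (b x))))))))))) :=
    (haa _).symm.trans (congrArg (fun y => a y) (hacbcbadcbcbadc x))
  have habacbdcbcb (x : X) : a (b (a (c (b (d (c (b (c (b x))))))))) = b (a (c (b (d (c (b (c (d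
      x)))))))) := by
    simpa only [hdb, hca, hdd, hda, haa, hbb, hcc, hcbcbc, hdcbd, hcbcbadcbcbadc] using
      habcbcbadcbcbadcbacd x
  have habcbdcbcb (x : X) : a (b (c (b (d (c (b (c (b x)))))))) = a (c (b (d (c (b (c (d x)))))))
      := by
    simpa only [haa, hbb] using
      (hbab _).symm.trans (congrArg (fun y => b y) (habacbdcbcb x))
  have hacbdcbcbd (x : X) : a (c (b (d (c (b (c (b (d x)))))))) = a (b (c (b (d (c (b (c x)))))))
      := by
    simpa only [hdb, hda, hbb, hcbcbc, hdcbd] using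
      (congrArg (fun y => d y) (habcbdcbcb x)).symm.trans (hda _)
  have hcbdcbcbd (x : X) : c (b (d (c (b (c (b (d x))))))) = b (c (b (d (c (b (c x)))))) := by
    simpa only [haa] using
      (haa _).symm.trans (congrArg (fun y => a y) (hacbdcbcbd x))
  simp only [hdb, hdd, hbb, hcc, hcbcbc, hdcbd, hdcbcdc, hcbdcbcbd]

/-- The order isomorphism between a principal ideal of the dual order and the dual of a principal
filter. -/
def iicToDual {α : Type*} [Preorder α] (x : α) :
    Set.Iic (OrderDual.toDual x) ≃o (Set.Ici x)ᵒᵈ where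
  toFun y := OrderDual.toDual ⟨OrderDual.ofDual y.1, y.2⟩
  invFun y := ⟨OrderDual.toDual (OrderDual.ofDual y).1, (OrderDual.ofDual y).2⟩
  left_inv _ := rfl
  right_inv _ := rfl
  map_rel_iff' := Iff.rfl

/-- The order isomorphism between a principal filter of the dual order and the dual of a principal
ideal. -/
def iciToDual {α : Type*} [Preorder α] (x : α) :
    Set.Ici (OrderDual.toDual x) ≃o (Set.Iic x)ᵒᵈ where
  toFun y := OrderDual.toDual ⟨OrderDual.ofDual y.1, y.2⟩
  invFun y := ⟨OrderDual.toDual (OrderDual.ofDual y).1, (OrderDual.ofDual y).2⟩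
  left_inv _ := rfl
  right_inv _ := rfl
  map_rel_iff' := Iff.rfl

namespace ProperFlag

variable {α : Type*} [PartialOrder α]

open FaceCode in
lemma isEmpty_of_hemiIcosa_dodeca (h : Thin α 4)
    (hfacet : ∀ f : ProperFlag α 4, Nonempty (Set.Iic (f.1 3) ≃o HemiIcosaPoset))
    (hvertex : ∀ f : ProperFlag α 4, Nonempty (Set.Ici (f.1 0) ≃o DodecaPoset)) :
    IsEmpty (ProperFlag α 4) := by
  have facet (f : ProperFlag α 4) :
      act h [1, 0, 1, 0, 1, 0] f = f ∧ act h [2, 1, 2, 1, 2, 1, 2, 1, 2, 1] f = f ∧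
        act h [1, 2, 0, 1, 2, 0, 1, 2, 0, 1, 2, 0, 1, 2, 0] f = f := by
    obtain ⟨e⟩ := hfacet f
    obtain ⟨g, hg⟩ := exists_act_eq_iff h encode encode_injective _
      (flip_encode hemiIcosa_flip hemiIcosa_codes) f e
    obtain ⟨h1, h2, h3⟩ := hemiIcosa_relations.encode hemiIcosa_codes g
    exact ⟨(hg _).2 h1, (hg _).2 h2, (hg _).2 h3⟩
  have vertex (f : ProperFlag α 4) :
      act h [3, 2, 3, 2, 3, 2] f = f ∧
        act h [2, 1, 3, 2, 1, 3, 2, 1, 3, 2, 1, 3, 2, 1, 3] f ≠ f := by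
    obtain ⟨e⟩ := hvertex f
    obtain ⟨g, hg⟩ := exists_act_eq_iff h.dual encode encode_injective _
      (flip_encode icosa_flip icosa_codes) f.dual ((iicToDual (f.1 0)).trans e.dual)
    obtain ⟨h1, h2⟩ := icosa_relations.encode icosa_codes g
    exact ⟨dual_injective ((act_dual h [3, 2, 3, 2, 3, 2] f).symm.trans ((hg _).2 h1)),
      fun hc => h2 ((hg _).1 ((act_dual h _ f).trans (congrArg dual hc)))⟩
  refine ⟨fun f => (vertex f).2 ?_⟩
  exact coxeter_collapse (flip h 0) (flip h 1) (flip h 2) (flip h 3)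
    (flip_flip h 0) (flip_flip h 1) (flip_flip h 2) (flip_flip h 3)
    (flip_comm h (by decide)) (flip_comm h (by decide)) (flip_comm h (by decide))
    (fun f => (facet f).1) (fun f => (facet f).2.1) (fun f => (vertex f).1)
    (fun f => (facet f).2.2) f

lemma isEmpty_of_icosa_hemiDodeca (h : Thin α 4)
    (hfacet : ∀ f : ProperFlag α 4, Nonempty (Set.Iic (f.1 3) ≃o IcosaPoset))
    (hvertex : ∀ f : ProperFlag α 4, Nonempty (Set.Ici (f.1 0) ≃o HemiDodecaPoset)) :
    IsEmpty (ProperFlag α 4) := by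
  have hdual : IsEmpty (ProperFlag αᵒᵈ 4) := by
    refine isEmpty_of_hemiIcosa_dodeca h.dual (fun f => ?_) fun f => ?_
    · obtain ⟨f, rfl⟩ := dual_surjective f
      exact (hvertex f).map fun e => (iicToDual (f.1 0)).trans e.dual
    · obtain ⟨f, rfl⟩ := dual_surjective f
      exact (hfacet f).map fun e => (iciToDual (f.1 3)).trans e.dual
  exact ⟨fun f => hdual.false f.dual⟩

end ProperFlag

namespace APolytope

variable (P : APolytope.{u} 4)

lemma isProperFlag_iff (f : Fin 4 → P.α) :
    (StrictMono f ∧ ∀ i, ¬ IsMin (f i) ∧ ¬ IsMax (f i)) ↔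
      ⊥ < f 0 ∧ f 0 < f 1 ∧ f 1 < f 2 ∧ f 2 < f 3 ∧ f 3 < ⊤ := by
  simp only [isMin_iff_eq_bot, isMax_iff_eq_top, ← bot_lt_iff_ne_bot, ← lt_top_iff_ne_top,
    ← ne_eq]
  constructor
  · rintro ⟨hf, h⟩
    exact ⟨(h 0).1, hf (by decide), hf (by decide), hf (by decide), (h 3).2⟩
  · rintro ⟨h0, h1, h2, h3, h4⟩
    refine ⟨Fin.strictMono_iff_lt_succ.2 fun i => ?_, fun i => ?_⟩
    · fin_cases i
      exacts [h1, h2, h3]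
    · fin_cases i
      exacts [⟨h0, h1.trans (h2.trans (h3.trans h4))⟩, ⟨h0.trans h1, h2.trans (h3.trans h4)⟩,
        ⟨h0.trans (h1.trans h2), h3.trans h4⟩, ⟨h0.trans (h1.trans (h2.trans h3)), h4⟩]

lemma rank_properFlag (f : ProperFlag P.α 4) (i : Fin 4) : P.rank (f.1 i) = i := by
  obtain ⟨h0, h1, h2, h3, h4⟩ := (P.isProperFlag_iff f.1).1 f.2
  have h0 := P.rank_strictMono h0
  have h1 := P.rank_strictMono h1
  have h2 := P.rank_strictMono h2
  have h3 := P.rank_strictMono h3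
  have h4 := P.rank_strictMono h4
  rw [P.rank_bot] at h0
  rw [P.rank_top] at h4
  push_cast at h4
  fin_cases i <;> simp <;> omega

lemma exists_section (f : ProperFlag P.α 4) (i : Fin 4) :
    ∃ F G, P.rank G = P.rank F + 2 ∧ ∀ x, (F < x ∧ x < G) ↔
      (StrictMono (Function.update f.1 i x) ∧
        ∀ j, ¬ IsMin (Function.update f.1 i x j) ∧ ¬ IsMax (Function.update f.1 i x j)) := by
  have hr := P.rank_properFlag f
  have hb := P.rank_bot
  have ht := P.rank_top
  obtain ⟨h0, h1, h2, h3, h4⟩ := (P.isProperFlag_iff f.1).1 f.2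
  simp only [isProperFlag_iff]
  fin_cases i
  · exact ⟨⊥, f.1 1, by simp [hr, hb], by simp [*]⟩
  · exact ⟨f.1 0, f.1 2, by simp [hr], by simp [*]⟩
  · exact ⟨f.1 1, f.1 3, by simp [hr], by simp [*]⟩
  · exact ⟨f.1 2, ⊤, by simp [hr, ht], by simp [*]⟩

lemma thin : ProperFlag.Thin P.α 4 := by
  intro f i
  obtain ⟨F, G, hFG, hsec⟩ := P.exists_section f i
  have hf : F < f.1 i ∧ f.1 i < G := (hsec _).2 (by simpa using f.2)
  obtain ⟨H₁, H₂, hne, hH⟩ := P.diamond F G (hf.1.trans hf.2) hFG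
  obtain ⟨H, hHf, hHFG, huniq⟩ :
      ∃ H, H ≠ f.1 i ∧ (F < H ∧ H < G) ∧ ∀ x, F < x ∧ x < G → x ≠ f.1 i → x = H := by
    rcases (hH _).1 hf with h | h
    · exact ⟨H₂, h ▸ hne.symm, (hH _).2 (Or.inr rfl),
        fun x hx hxf => ((hH x).1 hx).resolve_left (h ▸ hxf)⟩
    · exact ⟨H₁, h ▸ hne, (hH _).2 (Or.inl rfl),
        fun x hx hxf => ((hH x).1 hx).resolve_right (h ▸ hxf)⟩
  refine ⟨⟨Function.update f.1 i H, (hsec H).1 hHFG⟩, ⟨?_, fun j hj => ?_⟩, fun g hg => ?_⟩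
  · simpa using hHf
  · simp [hj]
  · have hgu : g.1 = Function.update f.1 i (g.1 i) := by
      funext j
      by_cases hj : j = i
      · subst hj; simp
      · simp [hj, hg.2 j hj]
    have hgH : g.1 i = H := huniq _ ((hsec _).2 (hgu ▸ g.2)) hg.1
    exact Subtype.ext (hgu.trans (by rw [hgH]))

lemma nonempty_properFlag : Nonempty (ProperFlag P.α 4) := by
  obtain ⟨c, hc, -⟩ := (IsChain.empty (r := ((· ≤ ·) : P.α → P.α → Prop))).exists_maxChain
  have hex (i : ℤ) (hi : i ∈ Set.Icc (-1 : ℤ) (4 : ℕ)) : ∃ F ∈ c, P.rank F = i :=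
    (P.flag_ranks c hc i hi).exists
  have hlt {F G : P.α} (hF : F ∈ c) (hG : G ∈ c) (h : P.rank F < P.rank G) : F < G := by
    refine ((hc.1.total hF hG).resolve_right fun hGF => ?_).lt_of_ne (by rintro rfl; omega)
    exact (P.rank_strictMono.monotone hGF).not_gt h
  obtain ⟨F₀, m₀, r₀⟩ := hex 0 (by simp)
  obtain ⟨F₁, m₁, r₁⟩ := hex 1 (by simp)
  obtain ⟨F₂, m₂, r₂⟩ := hex 2 (by simp)
  obtain ⟨F₃, m₃, r₃⟩ := hex 3 (by simp)
  have h₀₁ : F₀ < F₁ := hlt m₀ m₁ (by omega)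
  have h₁₂ : F₁ < F₂ := hlt m₁ m₂ (by omega)
  have h₂₃ : F₂ < F₃ := hlt m₂ m₃ (by omega)
  refine ⟨⟨![F₀, F₁, F₂, F₃], (P.isProperFlag_iff _).2 ⟨?_, h₀₁, h₁₂, h₂₃, ?_⟩⟩⟩
  · refine bot_lt_iff_ne_bot.2 fun h => ?_
    have := P.rank_bot
    simp only [Matrix.cons_val_zero] at h
    rw [← h] at this
    omega
  · refine lt_top_iff_ne_top.2 fun h => ?_
    have := P.rank_top
    change F₃ = ⊤ at h
    rw [← h] at this
    omega

end APolytope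

/-- There is no rank-4 abstract polytope all of whose facets are isomorphic to the
hemi-icosahedron `{3,5}₅` and all of whose vertex figures are isomorphic to the
dodecahedron `{5,3}`; dually, there is no rank-4 abstract polytope all of whose facets
are isomorphic to the icosahedron `{3,5}` and all of whose vertex figures are isomorphic
to the hemidodecahedron `{5,3}₅`. -/
theorem statement_6 :
    (¬ ∃ P : APolytope.{u} 4,
      P.FacetsAre HemiIcosaPoset ∧ P.VertexFiguresAre DodecaPoset) ∧
    (¬ ∃ P : APolytope.{u} 4,
      P.FacetsAre IcosaPoset ∧ P.VertexFiguresAre HemiDodecaPoset) := by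
  refine ⟨?_, ?_⟩
  · rintro ⟨P, hfacet, hvertex⟩
    exact (ProperFlag.isEmpty_of_hemiIcosa_dodeca P.thin
      (fun f => hfacet _ (P.rank_properFlag f 3))
      fun f => hvertex _ (P.rank_properFlag f 0)).false P.nonempty_properFlag.some
  · rintro ⟨P, hfacet, hvertex⟩
    exact (ProperFlag.isEmpty_of_icosa_hemiDodeca P.thin
      (fun f => hfacet _ (P.rank_properFlag f 3))
      fun f => hvertex _ (P.rank_properFlag f 0)).false P.nonempty_properFlag.some
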